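/- arXiv:1912.12312 — 2 statements merged into one kernel-verified Lean document; each statement's English description precedes it below -/
import Mathlib

section
/- (Criterion for basic Kottwitz–Rapoport strata; Proposition 'basic-fin'.) For every element w of the affine Coxeter group W of type C̃_g, the standard parabolic subgroup W_{supp(w) ∪ ι(supp(w))} is finite if and only if there exists an integer c with 0 ≤ c ≤ g/2 such that u_c ∉ supp(w) and u_{g−c} ∉ supp(w), i.e. if and only if w lies in the standard parabolic subgroup W_{S∖{u_c, u_{g−c}}} for some c ≤ g/2. -/
/-- The entries of the Coxeter matrix of type `C̃_g` (indices `0, 1, …, g`):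
`m(u_i, u_j) = 2` if `|i−j| ≥ 2`, `m(u_0,u_1) = m(u_{g−1},u_g) = 4`, and
`m(u_i,u_{i+1}) = 3` for `1 ≤ i ≤ g−2`. -/
def cAffEntry (g a b : ℕ) : ℕ :=
  if a = b then 1
  else if a + 1 < b ∨ b + 1 < a then 2
  else if (a = 0 ∧ b = 1) ∨ (b = 0 ∧ a = 1) ∨ (a = g - 1 ∧ b = g) ∨ (b = g - 1 ∧ a = g) then 4
  else 3

/-- The Coxeter matrix of type `C̃_g`, on the index set `{u_0, u_1, …, u_g} = Fin (g+1)`. -/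
def CAffMatrix (g : ℕ) : CoxeterMatrix (Fin (g + 1)) where
  M := Matrix.of fun a b => cAffEntry g (a : ℕ) (b : ℕ)
  isSymm := by
    ext a b
    simp only [Matrix.transpose_apply, Matrix.of_apply, cAffEntry]
    split_ifs <;> omega
  diagonal := by
    intro a
    simp [cAffEntry]
  off_diagonal := by
    intro a b hab
    have h : (a : ℕ) ≠ (b : ℕ) := fun h => hab (Fin.ext h)
    simp only [Matrix.of_apply, cAffEntry]
    split_ifs <;> omega

/-- The support of an element `w` of a Coxeter group: the set of indices of the simple
reflections occurring in some (equivalently, any) reduced expression of `w`. -/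
def supp {B W : Type*} [Group W] {M : CoxeterMatrix B} (cs : CoxeterSystem M W) (w : W) :
    Set B :=
  {i | ∃ ω : List B, cs.IsReduced ω ∧ cs.wordProd ω = w ∧ i ∈ ω}


open scoped Pointwise

section Relations

variable {G : Type*} [Group G]

theorem commute_of_mul_sq_eq_one {a b : G} (ha : a * a = 1) (hb : b * b = 1)
    (h : (a * b) ^ 2 = 1) : a * b = b * a := by
  have h1 : a * b = (a * b)⁻¹ := eq_inv_of_mul_eq_one_left (by rw [← pow_two, h])
  rw [h1, mul_inv_rev, ← eq_inv_of_mul_eq_one_left ha, ← eq_inv_of_mul_eq_one_left hb]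

theorem braid_of_mul_pow_three_eq_one {a b : G} (ha : a * a = 1) (hb : b * b = 1)
    (h : (a * b) ^ 3 = 1) : a * b * a = b * a * b := by
  have h1 : a * b * a = (b * a * b)⁻¹ :=
    eq_inv_of_mul_eq_one_left (by rw [← h]; simp only [pow_succ, pow_zero, one_mul, mul_assoc])
  rw [h1]
  simp only [mul_inv_rev, ← eq_inv_of_mul_eq_one_left ha, ← eq_inv_of_mul_eq_one_left hb,
    mul_assoc]

theorem braid_of_mul_pow_four_eq_one {a b : G} (ha : a * a = 1) (hb : b * b = 1)
    (h : (a * b) ^ 4 = 1) : a * b * a * b = b * a * b * a := by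
  have h1 : a * b * a * b = (a * b * a * b)⁻¹ :=
    eq_inv_of_mul_eq_one_left (by rw [← h]; simp only [pow_succ, pow_zero, one_mul, mul_assoc])
  rw [h1]
  simp only [mul_inv_rev, ← eq_inv_of_mul_eq_one_left ha, ← eq_inv_of_mul_eq_one_left hb,
    mul_assoc]

theorem mul_sq_eq_one_of_commute {a b : G} (ha : a * a = 1) (hb : b * b = 1)
    (h : a * b = b * a) : (a * b) ^ 2 = 1 := by
  rw [pow_two, mul_assoc, h, ← mul_assoc b b, hb, one_mul, ha]

theorem mul_pow_three_eq_one_of_braid {a b : G} (ha : a * a = 1) (hb : b * b = 1)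
    (h : a * b * a = b * a * b) : (a * b) ^ 3 = 1 := by
  calc (a * b) ^ 3 = (a * b * a) * (b * a * b) := by
        simp only [pow_succ, pow_zero, one_mul, mul_assoc]
    _ = (b * a * b) * (b * a * b) := by rw [h]
    _ = b * (a * (b * b) * a) * b := by simp only [mul_assoc]
    _ = 1 := by rw [hb, mul_one, ha, mul_one, hb]

theorem mul_pow_four_eq_one_of_braid {a b : G} (ha : a * a = 1) (hb : b * b = 1)
    (h : a * b * a * b = b * a * b * a) : (a * b) ^ 4 = 1 := by
  calc (a * b) ^ 4 = (a * b * a * b) * (a * b * a * b) := by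
        simp only [pow_succ, pow_zero, one_mul, mul_assoc]
    _ = (b * a * b * a) * (a * b * a * b) := by rw [h]
    _ = b * (a * (b * (a * a) * b) * a) * b := by simp only [mul_assoc]
    _ = 1 := by rw [ha, mul_one, hb, mul_one, ha, mul_one, hb]

end Relations

section TypeB

variable {G : Type*} [Group G]

/-- The elements `s 0, …, s (N - 1)` of a group satisfy the Coxeter relations of type `B_N`. -/
structure TypeBRelations (s : ℕ → G) (N : ℕ) : Prop where
  mul_self : ∀ i < N, s i * s i = 1
  comm : ∀ i j, i + 2 ≤ j → j < N → s i * s j = s j * s i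
  braid : ∀ i, 1 ≤ i → i + 1 < N → s i * s (i + 1) * s i = s (i + 1) * s i * s (i + 1)
  braid_zero : 1 < N → s 0 * s 1 * s 0 * s 1 = s 1 * s 0 * s 1 * s 0

/-- The ascending product `s j * s (j + 1) * ⋯ * s (j + m - 1)`. -/
def ascProd (s : ℕ → G) : ℕ → ℕ → G
  | _, 0 => 1
  | j, m + 1 => s j * ascProd s (j + 1) m

/-- The descending product `s k * s (k - 1) * ⋯ * s 1`. -/
def descProd (s : ℕ → G) : ℕ → G
  | 0 => 1
  | k + 1 => s (k + 1) * descProd s k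

namespace TypeBRelations

variable {s : ℕ → G} {N : ℕ}

theorem mono (h : TypeBRelations s N) {n : ℕ} (hn : n ≤ N) : TypeBRelations s n where
  mul_self i hi := h.mul_self i (by omega)
  comm i j hij hj := h.comm i j hij (by omega)
  braid i hi hi' := h.braid i hi (by omega)
  braid_zero hn' := h.braid_zero (by omega)

theorem mul_ascProd_of_lt (h : TypeBRelations s N) {i : ℕ} (m : ℕ) {j : ℕ} (hij : i + 2 ≤ j)
    (hj : j + m ≤ N) : s i * ascProd s j m = ascProd s j m * s i := by
  induction m generalizing j with
  | zero => simp [ascProd]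
  | succ m ih =>
    rw [ascProd, ← mul_assoc, h.comm i j hij (by omega), mul_assoc,
      ih (by omega) (by omega), mul_assoc]

theorem mul_ascProd_of_le (h : TypeBRelations s N) {i : ℕ} (hi : 1 ≤ i) (m : ℕ) {j : ℕ}
    (hij : j ≤ i) (him : i + 1 < j + m) (hj : j + m ≤ N) :
    s (i + 1) * ascProd s j m = ascProd s j m * s i := by
  induction m generalizing j with
  | zero => omega
  | succ m ih =>
    rcases hij.lt_or_eq with hlt | rfl
    · rw [ascProd, ← mul_assoc, ← h.comm j (i + 1) (by omega) (by omega), mul_assoc,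
        ih (by omega) (by omega) (by omega), mul_assoc]
    · obtain ⟨m, rfl⟩ : ∃ m', m = m' + 1 := ⟨m - 1, by omega⟩
      simp only [ascProd]
      rw [← mul_assoc, ← mul_assoc, ← h.braid j hi (by omega), mul_assoc,
        h.mul_ascProd_of_lt m (by omega) (by omega)]
      simp only [mul_assoc]

theorem mul_descProd_of_gt (h : TypeBRelations s N) {i : ℕ} (hi : i < N) {k : ℕ}
    (hk : k + 2 ≤ i) : s i * descProd s k = descProd s k * s i := by
  induction k with
  | zero => simp [descProd]
  | succ k ih =>
    rw [descProd, ← mul_assoc, ← h.comm (k + 1) i hk hi, mul_assoc, ih (by omega), mul_assoc]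

theorem mul_descProd_of_lt (h : TypeBRelations s N) {i : ℕ} (hi : 1 ≤ i) {k : ℕ}
    (hik : i < k) (hk : k < N) : s i * descProd s k = descProd s k * s (i + 1) := by
  induction k with
  | zero => omega
  | succ k ih =>
    rcases (Nat.lt_succ_iff.1 hik).lt_or_eq with hlt | rfl
    · rw [descProd, ← mul_assoc, h.comm i (k + 1) (by omega) hk, mul_assoc,
        ih hlt (by omega), mul_assoc]
    · obtain ⟨k, rfl⟩ : ∃ k', i = k' + 1 := ⟨i - 1, by omega⟩
      simp only [descProd]
      rw [← mul_assoc, ← mul_assoc, h.braid (k + 1) hi hk, mul_assoc,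
        h.mul_descProd_of_gt hk le_rfl]
      simp only [mul_assoc]

theorem zero_mul_descProd_mul_ascProd (h : TypeBRelations s N) {n : ℕ} (hn : n < N) {k : ℕ}
    (hk : 1 ≤ k) (hkn : k ≤ n) : s 0 * (descProd s k * ascProd s 0 (n + 1)) =
      descProd s k * ascProd s 0 (n + 1) * s 0 := by
  induction k, hk using Nat.le_induction with
  | base =>
    obtain ⟨m, rfl⟩ : ∃ m, n = m + 1 := ⟨n - 1, by omega⟩
    simp only [descProd, ascProd, mul_one, zero_add]
    have h4 := h.braid_zero (by omega)
    have hD := h.mul_ascProd_of_lt (i := 0) m (j := 2) (by omega) (by omega)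
    calc s 0 * (s 1 * (s 0 * (s 1 * ascProd s 2 m)))
        = s 0 * s 1 * s 0 * s 1 * ascProd s 2 m := by simp only [mul_assoc]
      _ = s 1 * s 0 * s 1 * (s 0 * ascProd s 2 m) := by rw [h4, mul_assoc]
      _ = s 1 * (s 0 * (s 1 * ascProd s 2 m)) * s 0 := by rw [hD]; simp only [mul_assoc]
  | succ k hk ih =>
    rw [descProd, mul_assoc, ← mul_assoc, h.comm 0 (k + 1) (by omega) (by omega), mul_assoc,
      ih (by omega)]
    simp only [mul_assoc]

/-- A group generated by elements satisfying the relations of type `B_N` is finite: the subgroup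
generated by the first `n` generators has at most `2 (n + 1)` cosets in the next one. -/
theorem finite_closure (h : TypeBRelations s N) :
    (Subgroup.closure (s '' Set.Iio N) : Set G).Finite := by
  induction N with
  | zero => simp
  | succ n ih =>
    set H := Subgroup.closure (s '' Set.Iio n) with hH
    have hsH : ∀ i < n, s i ∈ H := fun i hi => Subgroup.subset_closure ⟨i, hi, rfl⟩
    set D : ℕ → G := fun k => ascProd s k (n + 1 - k) with hD
    set E : ℕ → G := fun k => descProd s k * ascProd s 0 (n + 1) with hE
    set R : Set G := D '' Set.Iic (n + 1) ∪ E '' Set.Iic n with hR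
    have hRfin : R.Finite := ((Set.finite_Iic _).image _).union ((Set.finite_Iic _).image _)
    have hDR : ∀ k ≤ n + 1, D k ∈ R := fun k hk => Or.inl ⟨k, hk, rfl⟩
    have hER : ∀ k ≤ n, E k ∈ R := fun k hk => Or.inr ⟨k, hk, rfl⟩
    have hD0 : D 0 = ascProd s 0 (n + 1) := rfl
    have hE0 : E 0 = D 0 := by simp [hE, hD, descProd]
    have hDs : ∀ k ≤ n, D k = s k * D (k + 1) := fun k hk => by
      simp only [hD]
      rw [show n + 1 - k = (n + 1 - (k + 1)) + 1 by omega, ascProd]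
    have hEs : ∀ k, E (k + 1) = s (k + 1) * E k := fun k => by
      simp only [hE, descProd, mul_assoc]
    have key : ∀ i ≤ n, ∀ r ∈ R, ∃ r' ∈ R, ∃ x ∈ H, s i * r = r' * x := by
      intro i hi r hr
      have hsq := h.mul_self i (by omega)
      have cancel : ∀ x : G, s i * (s i * x) = x := fun x => by rw [← mul_assoc, hsq, one_mul]
      rcases hr with ⟨k, hk, rfl⟩ | ⟨k, hk, rfl⟩
      · rw [Set.mem_Iic] at hk
        rcases lt_trichotomy i k with hik | rfl | hik
        · rcases Nat.lt_or_ge (i + 1) k with hik' | hik'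
          · exact ⟨D k, hDR k hk, s i, hsH i (by omega), h.mul_ascProd_of_lt _ hik' (by omega)⟩
          · obtain rfl : k = i + 1 := by omega
            exact ⟨D i, hDR i (by omega), 1, H.one_mem, by rw [mul_one, hDs i hi]⟩
        · exact ⟨D (i + 1), hDR _ (by omega), 1, H.one_mem, by rw [mul_one, hDs i hi, cancel]⟩
        · obtain ⟨i, rfl⟩ : ∃ i', i = i' + 1 := ⟨i - 1, by omega⟩
          rcases Nat.eq_zero_or_pos i with rfl | hi0
          · obtain rfl : k = 0 := by omega
            exact ⟨E 1, hER 1 hi, 1, H.one_mem, by rw [mul_one, hEs 0, hE0]⟩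
          · exact ⟨D k, hDR k hk, s i, hsH i (by omega),
              h.mul_ascProd_of_le hi0 _ (by omega) (by omega) (by omega)⟩
      · rw [Set.mem_Iic] at hk
        rcases lt_trichotomy i k with hik | rfl | hik
        · refine ⟨E k, hER k hk, s i, hsH i (by omega), ?_⟩
          rcases Nat.eq_zero_or_pos i with rfl | hi0
          · exact h.zero_mul_descProd_mul_ascProd (by omega) hik hk
          · simp only [hE]
            rw [← mul_assoc, h.mul_descProd_of_lt hi0 hik (by omega), mul_assoc,
              h.mul_ascProd_of_le hi0 _ (by omega) (by omega) (by omega), mul_assoc]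
        · rcases Nat.eq_zero_or_pos i with rfl | hi0
          · exact ⟨D 1, hDR 1 (by omega), 1, H.one_mem,
              by rw [mul_one, hE0, hDs 0 (by omega), cancel]⟩
          · obtain ⟨i, rfl⟩ : ∃ i', i = i' + 1 := ⟨i - 1, by omega⟩
            exact ⟨E i, hER i (by omega), 1, H.one_mem, by rw [mul_one, hEs, cancel]⟩
        · rcases Nat.lt_or_ge (k + 1) i with hik' | hik'
          · obtain ⟨i, rfl⟩ : ∃ i', i = i' + 1 := ⟨i - 1, by omega⟩
            refine ⟨E k, hER k hk, s i, hsH i (by omega), ?_⟩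
            simp only [hE]
            rw [← mul_assoc, h.mul_descProd_of_gt (by omega) hik', mul_assoc,
              h.mul_ascProd_of_le (by omega) _ (by omega) (by omega) (by omega), mul_assoc]
          · obtain rfl : i = k + 1 := by omega
            exact ⟨E (k + 1), hER _ hi, 1, H.one_mem, by rw [mul_one, hEs]⟩
    refine (hRfin.mul (ih (h.mono n.le_succ))).subset ?_
    have step : ∀ i < n + 1, ∀ y ∈ R * (H : Set G), s i * y ∈ R * (H : Set G) := by
      rintro i hi _ ⟨r, hr, x, hx, rfl⟩
      obtain ⟨r', hr', x', hx', he⟩ := key i (by omega) r hr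
      exact ⟨r', hr', x' * x, H.mul_mem hx' hx, by
        simp only [← mul_assoc, he]⟩
    intro y hy
    induction hy using Subgroup.closure_induction_left with
    | one => exact ⟨D (n + 1), hDR _ le_rfl, 1, H.one_mem, by simp [hD, ascProd]⟩
    | mul_left x hx y _ hy =>
      obtain ⟨i, hi, rfl⟩ := hx
      exact step i hi y hy
    | inv_mul_cancel x hx y _ hy =>
      obtain ⟨i, hi, rfl⟩ := hx
      rw [← eq_inv_of_mul_eq_one_left (h.mul_self i hi)]
      exact step i hi y hy

end TypeBRelations

theorem Subgroup.finite_sup_of_commute {A B : Subgroup G} [Finite A] [Finite B]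
    (h : ∀ a ∈ A, ∀ b ∈ B, Commute a b) : Finite ↥(A ⊔ B) := by
  have hAB : ∀ (a : A) (b : B), Commute (A.subtype a) (B.subtype b) :=
    fun a b => h a a.2 b b.2
  have hr := MonoidHom.noncommCoprod_range A.subtype B.subtype hAB
  rw [A.range_subtype, B.range_subtype] at hr
  rw [← hr]
  exact Set.finite_range _

end TypeB

theorem cAffEntry_self (g a : ℕ) : cAffEntry g a a = 1 := by simp [cAffEntry]

theorem cAffEntry_of_far (g : ℕ) {a b : ℕ} (h : a + 1 < b ∨ b + 1 < a) :
    cAffEntry g a b = 2 := by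
  rw [cAffEntry, if_neg (by omega), if_pos h]

theorem cAffEntry_of_interior {g a b : ℕ} (h : a + 1 = b ∨ b + 1 = a) (ha : 1 ≤ a) (hb : 1 ≤ b)
    (ha' : a < g) (hb' : b < g) : cAffEntry g a b = 3 := by
  rw [cAffEntry, if_neg (by omega), if_neg (by omega), if_neg (by omega)]

theorem cAffEntry_of_end {g a b : ℕ} (h : a + 1 = b ∨ b + 1 = a)
    (h' : a = 0 ∨ b = 0 ∨ a = g ∨ b = g) (ha : a ≤ g) (hb : b ≤ g) : cAffEntry g a b = 4 := by
  rw [cAffEntry, if_neg (by omega), if_neg (by omega), if_pos (by omega)]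

section Proper

variable {g : ℕ} {W : Type*} [Group W] (cs : CoxeterSystem (CAffMatrix g) W)

theorem simple_ofNat_mul_pow {i j : ℕ} (hi : i ≤ g) (hj : j ≤ g) :
    (cs.simple (Fin.ofNat (g + 1) i) * cs.simple (Fin.ofNat (g + 1) j)) ^ cAffEntry g i j = 1 := by
  have h := cs.simple_mul_simple_pow (Fin.ofNat (g + 1) i) (Fin.ofNat (g + 1) j)
  have hM : (CAffMatrix g) (Fin.ofNat (g + 1) i) (Fin.ofNat (g + 1) j) =
      cAffEntry g (i % (g + 1)) (j % (g + 1)) := rfl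
  rwa [hM, Nat.mod_eq_of_lt (by omega), Nat.mod_eq_of_lt (by omega)] at h

theorem simple_ofNat_comm {i j : ℕ} (hi : i ≤ g) (hj : j ≤ g) (hij : i + 1 < j ∨ j + 1 < i) :
    cs.simple (Fin.ofNat (g + 1) i) * cs.simple (Fin.ofNat (g + 1) j) =
      cs.simple (Fin.ofNat (g + 1) j) * cs.simple (Fin.ofNat (g + 1) i) := by
  have h := simple_ofNat_mul_pow cs hi hj
  rw [cAffEntry_of_far g hij] at h
  exact commute_of_mul_sq_eq_one (cs.simple_mul_simple_self _) (cs.simple_mul_simple_self _) h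

theorem typeBRelations_left {c : ℕ} (hc : c ≤ g) :
    TypeBRelations (fun i => cs.simple (Fin.ofNat (g + 1) i)) c where
  mul_self i _ := cs.simple_mul_simple_self _
  comm i j hij hj := simple_ofNat_comm cs (by omega) (by omega) (by omega)
  braid i hi hic := by
    have h := simple_ofNat_mul_pow cs (i := i) (j := i + 1) (by omega) (by omega)
    rw [cAffEntry_of_interior (by omega) (by omega) (by omega) (by omega) (by omega)] at h
    exact braid_of_mul_pow_three_eq_one (cs.simple_mul_simple_self _)
      (cs.simple_mul_simple_self _) h
  braid_zero hc' := by
    have h := simple_ofNat_mul_pow cs (i := 0) (j := 1) (by omega) (by omega)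
    rw [cAffEntry_of_end (by omega) (by omega) (by omega) (by omega)] at h
    exact braid_of_mul_pow_four_eq_one (cs.simple_mul_simple_self _)
      (cs.simple_mul_simple_self _) h

theorem typeBRelations_right {c : ℕ} (hc : c ≤ g) :
    TypeBRelations (fun i => cs.simple (Fin.ofNat (g + 1) (g - i))) c where
  mul_self i _ := cs.simple_mul_simple_self _
  comm i j hij hj := simple_ofNat_comm cs (by omega) (by omega) (by omega)
  braid i hi hic := by
    have h := simple_ofNat_mul_pow cs (i := g - i) (j := g - (i + 1)) (by omega) (by omega)
    rw [cAffEntry_of_interior (by omega) (by omega) (by omega) (by omega) (by omega)] at h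
    exact braid_of_mul_pow_three_eq_one (cs.simple_mul_simple_self _)
      (cs.simple_mul_simple_self _) h
  braid_zero hc' := by
    have h := simple_ofNat_mul_pow cs (i := g - 0) (j := g - 1) (by omega) (by omega)
    rw [cAffEntry_of_end (by omega) (by omega) (by omega) (by omega)] at h
    exact braid_of_mul_pow_four_eq_one (cs.simple_mul_simple_self _)
      (cs.simple_mul_simple_self _) h

/-- A proper standard parabolic subgroup of the affine Weyl group of type `C̃_g` is finite. -/
theorem finite_closure_simple_of_notMem {K : Set (Fin (g + 1))} {c : Fin (g + 1)} (hc : c ∉ K) :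
    Finite ↥(Subgroup.closure (cs.simple '' K)) := by
  have hcg := c.is_lt
  set A := Subgroup.closure ((fun i => cs.simple (Fin.ofNat (g + 1) i)) '' Set.Iio (c : ℕ))
    with hA
  set B := Subgroup.closure
    ((fun i => cs.simple (Fin.ofNat (g + 1) (g - i))) '' Set.Iio (g - (c : ℕ))) with hB
  have : Finite A := (typeBRelations_left cs (c := c) (by omega)).finite_closure
  have : Finite B := (typeBRelations_right cs (c := g - c) (by omega)).finite_closure
  have hAB : ∀ a ∈ A, ∀ b ∈ B, Commute a b := by
    have hle : A ≤ Subgroup.centralizer (B : Set W) := by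
      rw [hB, Subgroup.centralizer_closure, hA, Subgroup.closure_le]
      rintro _ ⟨i, hi, rfl⟩
      rw [SetLike.mem_coe, Subgroup.mem_centralizer_iff]
      rintro _ ⟨j, hj, rfl⟩
      rw [Set.mem_Iio] at hi hj
      exact simple_ofNat_comm cs (by omega) (by omega) (by omega)
    exact fun a ha b hb => (Subgroup.mem_centralizer_iff.1 (hle ha) b hb).symm
  have hfin : Finite ↥(A ⊔ B) := Subgroup.finite_sup_of_commute hAB
  refine Set.Finite.subset hfin ((Subgroup.closure_le (A ⊔ B)).2 ?_)
  rintro _ ⟨i, hi, rfl⟩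
  have hic : (i : ℕ) ≠ c := fun h => hc (Fin.ext h ▸ hi)
  have hig := i.is_lt
  rcases hic.lt_or_gt with hlt | hgt
  · refine Subgroup.mem_sup_left (Subgroup.subset_closure ⟨i, hlt, ?_⟩)
    simp
  · refine Subgroup.mem_sup_right (Subgroup.subset_closure ⟨g - i, ?_, ?_⟩)
    · rw [Set.mem_Iio]; omega
    · simp [show g - (g - (i : ℕ)) = i by omega]

end Proper

section Infinite

/-- The action of the generator `u_i` of the affine Weyl group of type `C̃_g` on pairs `(k, n)`,
to be thought of as the hyperplanes `x_k = n`: the generator `u_0` acts by `x_0 ↦ -x_0`, `u_g` by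
`x_{g-1} ↦ 1 - x_{g-1}`, and the others by exchanging consecutive coordinates. -/
def affAct (g i : ℕ) (p : ℕ × ℤ) : ℕ × ℤ :=
  if i = 0 then (if p.1 = 0 then (p.1, -p.2) else p)
  else if i = g then (if p.1 = g - 1 then (p.1, 1 - p.2) else p)
  else if p.1 = i - 1 then (i, p.2) else if p.1 = i then (i - 1, p.2) else p

theorem affAct_zero (g : ℕ) (p : ℕ × ℤ) :
    affAct g 0 p = if p.1 = 0 then (p.1, -p.2) else p := rfl

theorem affAct_last {g : ℕ} (hg : g ≠ 0) (p : ℕ × ℤ) :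
    affAct g g p = if p.1 = g - 1 then (p.1, 1 - p.2) else p := by
  simp [affAct, hg]

theorem affAct_interior {g i : ℕ} (hi : i ≠ 0) (hig : i ≠ g) (p : ℕ × ℤ) :
    affAct g i p = (Equiv.swap (i - 1) i p.1, p.2) := by
  rw [affAct, if_neg hi, if_neg hig, Equiv.swap_apply_def]
  split_ifs <;> rfl

theorem affAct_involutive (g i : ℕ) : Function.Involutive (affAct g i) := by
  rintro ⟨k, n⟩
  rcases eq_or_ne i 0 with rfl | hi
  · simp only [affAct_zero]; split_ifs <;> simp_all
  rcases eq_or_ne i g with rfl | hig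
  · simp only [affAct_last hi]; split_ifs <;> simp_all
  · simp only [affAct_interior hi hig, Equiv.swap_apply_self]

theorem affAct_comm {g i j : ℕ} (hg : 2 ≤ g) (hj : j ≤ g) (hij : i + 2 ≤ j) (p : ℕ × ℤ) :
    affAct g i (affAct g j p) = affAct g j (affAct g i p) := by
  obtain ⟨k, n⟩ := p
  rcases eq_or_ne i 0 with rfl | hi <;> rcases eq_or_ne j g with rfl | hjg
  · simp only [affAct_zero, affAct_last (show j ≠ 0 by omega)]
    split_ifs <;> grind
  · simp only [affAct_zero, affAct_interior (show j ≠ 0 by omega) hjg, Equiv.swap_apply_def]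
    split_ifs <;> grind
  · simp only [affAct_last (show j ≠ 0 by omega), affAct_interior hi (show i ≠ j by omega),
      Equiv.swap_apply_def]
    split_ifs <;> grind
  · simp only [affAct_interior hi (show i ≠ g by omega),
      affAct_interior (show j ≠ 0 by omega) hjg, Equiv.swap_apply_def]
    split_ifs <;> grind

theorem affAct_braid {g i : ℕ} (hi : 1 ≤ i) (hig : i + 1 < g) (p : ℕ × ℤ) :
    affAct g i (affAct g (i + 1) (affAct g i p)) =
      affAct g (i + 1) (affAct g i (affAct g (i + 1) p)) := by
  obtain ⟨k, n⟩ := p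
  simp only [affAct_interior (show i ≠ 0 by omega) (show i ≠ g by omega),
    affAct_interior (show i + 1 ≠ 0 by omega) (show i + 1 ≠ g by omega), Nat.add_sub_cancel,
    ← Equiv.Perm.mul_apply]
  rw [← mul_assoc, ← mul_assoc,
    Equiv.swap_mul_swap_mul_swap (x := i - 1) (y := i) (z := i + 1) (by omega) (by omega),
    Equiv.swap_comm (i - 1) i, Equiv.swap_comm i (i + 1),
    Equiv.swap_mul_swap_mul_swap (x := i + 1) (by omega) (by omega), Equiv.swap_comm]

theorem affAct_braid_zero {g : ℕ} (hg : 2 ≤ g) (p : ℕ × ℤ) :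
    affAct g 0 (affAct g 1 (affAct g 0 (affAct g 1 p))) =
      affAct g 1 (affAct g 0 (affAct g 1 (affAct g 0 p))) := by
  obtain ⟨k, n⟩ := p
  simp only [affAct_zero, affAct_interior one_ne_zero (show 1 ≠ g by omega), Nat.sub_self]
  rcases eq_or_ne k 0 with rfl | h0
  · simp
  rcases eq_or_ne k 1 with rfl | h1
  · simp
  · simp [h0, Equiv.swap_apply_of_ne_of_ne h0 h1]

theorem affAct_braid_last {g : ℕ} (hg : 2 ≤ g) (p : ℕ × ℤ) :
    affAct g (g - 1) (affAct g g (affAct g (g - 1) (affAct g g p))) =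
      affAct g g (affAct g (g - 1) (affAct g g (affAct g (g - 1) p))) := by
  obtain ⟨k, n⟩ := p
  have hne : g - 1 - 1 ≠ g - 1 := by omega
  simp only [affAct_last (show g ≠ 0 by omega),
    affAct_interior (show g - 1 ≠ 0 by omega) (show g - 1 ≠ g by omega)]
  rcases eq_or_ne k (g - 1) with rfl | h0
  · simp [hne]
  rcases eq_or_ne k (g - 1 - 1) with rfl | h1
  · simp [hne]
  · simp [h0, Equiv.swap_apply_of_ne_of_ne h1 h0]

/-- The permutation of `ℕ × ℤ` given by `affAct`. -/
def affPerm (g i : ℕ) : Equiv.Perm (ℕ × ℤ) := (affAct_involutive g i).toPerm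

theorem affPerm_apply (g i : ℕ) (p : ℕ × ℤ) : affPerm g i p = affAct g i p := rfl

theorem affPerm_mul_self (g i : ℕ) : affPerm g i * affPerm g i = 1 :=
  Equiv.ext fun p => affAct_involutive g i p

theorem affPerm_mul_pow_of_le {g : ℕ} (hg : 2 ≤ g) {i j : ℕ} (hij : i ≤ j) (hj : j ≤ g) :
    (affPerm g i * affPerm g j) ^ cAffEntry g i j = 1 := by
  have hi2 := affPerm_mul_self g i
  have hj2 := affPerm_mul_self g j
  rcases hij.eq_or_lt with rfl | hlt
  · rw [cAffEntry_self, pow_one, hi2]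
  rcases Nat.lt_or_ge (i + 1) j with hlt' | hge
  · rw [cAffEntry_of_far g (Or.inl hlt')]
    exact mul_sq_eq_one_of_commute hi2 hj2 (Equiv.ext fun p => affAct_comm hg hj hlt' p)
  obtain rfl : j = i + 1 := by omega
  rcases Nat.eq_zero_or_pos i with rfl | hi0
  · rw [cAffEntry_of_end (by omega) (by omega) (by omega) hj]
    exact mul_pow_four_eq_one_of_braid hi2 hj2 (Equiv.ext fun p => affAct_braid_zero hg p)
  rcases hj.eq_or_lt with rfl | hjg
  · rw [cAffEntry_of_end (by omega) (by omega) (by omega) hj]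
    exact mul_pow_four_eq_one_of_braid hi2 hj2 (Equiv.ext fun p => affAct_braid_last hg p)
  · rw [cAffEntry_of_interior (by omega) hi0 (by omega) (by omega) hjg]
    exact mul_pow_three_eq_one_of_braid hi2 hj2 (Equiv.ext fun p => affAct_braid hi0 hjg p)

theorem affPerm_isLiftable {g : ℕ} (hg : 2 ≤ g) :
    (CAffMatrix g).IsLiftable fun i : Fin (g + 1) => affPerm g i := by
  intro i j
  rcases le_total (i : ℕ) j with h | h
  · exact affPerm_mul_pow_of_le hg h (by omega)
  · rw [(CAffMatrix g).symmetric, ← inv_inj, ← inv_pow, mul_inv_rev, inv_one,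
      ← eq_inv_of_mul_eq_one_left (affPerm_mul_self g i),
      ← eq_inv_of_mul_eq_one_left (affPerm_mul_self g j)]
    exact affPerm_mul_pow_of_le hg h (by omega)

variable {g : ℕ} {W : Type*} [Group W]

/-- The affine Weyl group of type `C̃_g` is infinite. -/
theorem infinite_of_coxeterSystem_CAffMatrix (hg : 2 ≤ g) (cs : CoxeterSystem (CAffMatrix g) W) :
    Infinite W := by
  set φ : W →* Equiv.Perm (ℕ × ℤ) := cs.lift ⟨_, affPerm_isLiftable hg⟩ with hφ
  have hφs : ∀ i : Fin (g + 1), ∀ p, φ (cs.simple i) p = affAct g i p := fun i p => by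
    rw [hφ, cs.lift_apply_simple (affPerm_isLiftable hg), affPerm_apply]
  set O : Set (ℕ × ℤ) := Set.range fun w => φ w (0, 0) with hO
  have hstep : ∀ i ≤ g, ∀ p ∈ O, affAct g i p ∈ O := by
    rintro i hi _ ⟨w, rfl⟩
    exact ⟨cs.simple ⟨i, by omega⟩ * w, by simp [hφs]⟩
  have hup : ∀ n : ℤ, ∀ j < g, (0, n) ∈ O → (j, n) ∈ O := by
    intro n j hj h0
    induction j with
    | zero => exact h0
    | succ j ih =>
      have h := hstep (j + 1) (by omega) _ (ih (by omega))
      rwa [affAct_interior (by omega) (by omega), Nat.add_sub_cancel, Equiv.swap_apply_left] at h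
  have hdown : ∀ n : ℤ, ∀ j < g, (j, n) ∈ O → (0, n) ∈ O := by
    intro n j hj h0
    induction j with
    | zero => exact h0
    | succ j ih =>
      have h := hstep (j + 1) (by omega) _ h0
      rw [affAct_interior (by omega) (by omega), Nat.add_sub_cancel,
        Equiv.swap_apply_right] at h
      exact ih (by omega) h
  have htrans : ∀ m : ℕ, ((0 : ℕ), (m : ℤ)) ∈ O := by
    intro m
    induction m with
    | zero => exact ⟨1, by simp⟩
    | succ m ih =>
      have h0 := hstep 0 (by omega) _ ih
      rw [affAct_zero, if_pos rfl] at h0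
      have h1 := hstep g le_rfl _ (hup _ (g - 1) (by omega) h0)
      rw [affAct_last (by omega), if_pos rfl] at h1
      have h2 := hdown _ (g - 1) (by omega) h1
      rwa [show 1 - -(m : ℤ) = ((m + 1 : ℕ) : ℤ) by push_cast; ring] at h2
  by_contra hW
  rw [not_infinite_iff_finite] at hW
  have hfin : O.Finite := Set.finite_range _
  refine Set.infinite_of_injective_forall_mem (f := fun m : ℕ => ((0 : ℕ), (m : ℤ))) ?_ htrans hfin
  intro a b hab
  simpa using hab

end Infinite

/-- Criterion for basic Kottwitz–Rapoport strata (Proposition `basic-fin`): for every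
element `w` of the affine Coxeter group `W` of type `C̃_g`, the standard parabolic subgroup
`W_{supp(w) ∪ ι(supp(w))}` (where `ι(u_i) = u_{g−i}`) is finite if and only if there exists
an integer `c` with `0 ≤ c ≤ g/2` such that `u_c ∉ supp(w)` and `u_{g−c} ∉ supp(w)`. -/
theorem basic_KR_criterion (g : ℕ) (hg : 2 ≤ g) {W : Type*} [Group W]
    (cs : CoxeterSystem (CAffMatrix g) W) (w : W) :
    Finite ↥(Subgroup.closure (cs.simple ''
        (supp cs w ∪
          (fun i : Fin (g + 1) => (⟨g - (i : ℕ), by omega⟩ : Fin (g + 1))) '' supp cs w))) ↔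
      ∃ c : ℕ, ∃ _ : 2 * c ≤ g,
        (⟨c, by omega⟩ : Fin (g + 1)) ∉ supp cs w ∧
        (⟨g - c, by omega⟩ : Fin (g + 1)) ∉ supp cs w := by
  constructor
  · intro hfin
    by_contra! hc
    have huniv : supp cs w ∪
        (fun i : Fin (g + 1) => (⟨g - (i : ℕ), by omega⟩ : Fin (g + 1))) '' supp cs w =
          Set.univ := by
      refine Set.eq_univ_of_forall fun i => or_iff_not_imp_left.2 fun hi => ?_
      have hig := i.is_lt
      refine ⟨⟨g - i, by omega⟩, ?_, Fin.ext (by simp only; omega)⟩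
      rcases Nat.lt_or_ge g (2 * i) with h | h
      · by_contra hi'
        refine hi ?_
        convert hc (g - i) (by omega) hi' using 1
        exact Fin.ext (by simp only; omega)
      · exact hc i h hi
    rw [huniv, Set.image_univ, cs.subgroup_closure_range_simple] at hfin
    have := infinite_of_coxeterSystem_CAffMatrix hg cs
    exact not_finite_iff_infinite.2 this (Finite.of_equiv _ Subgroup.topEquiv.toEquiv)
  · rintro ⟨c, hcg, hc, hc'⟩
    refine finite_closure_simple_of_notMem cs (c := ⟨c, by omega⟩) ?_
    rintro (h | ⟨i, hi, hic⟩)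
    · exact hc h
    · have hig := i.is_lt
      have hic' : g - (i : ℕ) = c := congrArg Fin.val hic
      refine hc' ?_
      convert hi using 1
      exact Fin.ext (by simp only; omega)
end

section
/- For every w ∈ ᵍW with w ≠ 1, the support of w is an interval ending at t_g: there exists i with 1 ≤ i ≤ g such that supp(w) = {t_i, t_{i+1}, …, t_g}. -/
/-- The entries of the Coxeter matrix of type `C_g`; the index `a : Fin g` (0-based)
corresponds to the simple reflection `t_{a+1}` of the paper:  `m(t_i, t_j) = 2` if
`|i−j| ≥ 2`, `m(t_i, t_{i+1}) = 3` for `1 ≤ i ≤ g−2`, and `m(t_{g−1}, t_g) = 4`. -/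
def cFinEntry (g a b : ℕ) : ℕ :=
  if a = b then 1
  else if a + 1 < b ∨ b + 1 < a then 2
  else if (a = g - 2 ∧ b = g - 1) ∨ (b = g - 2 ∧ a = g - 1) then 4
  else 3

/-- The Coxeter matrix of type `C_g` (the Weyl group of `Sp_{2g}`), on the index set
`Fin g` (the index `a` corresponds to the simple reflection `t_{a+1}` of the paper). -/
def CFinMatrix (g : ℕ) : CoxeterMatrix (Fin g) where
  M := Matrix.of fun a b => cFinEntry g (a : ℕ) (b : ℕ)
  isSymm := by
    ext a b
    simp only [Matrix.transpose_apply, Matrix.of_apply, cFinEntry]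
    split_ifs <;> omega
  diagonal := by
    intro a
    simp [cFinEntry]
  off_diagonal := by
    intro a b hab
    have h : (a : ℕ) ≠ (b : ℕ) := fun h => hab (Fin.ext h)
    simp only [Matrix.of_apply, cFinEntry]
    split_ifs <;> omega

/-- The standard parabolic subgroup `W_c = ⟨t_{g−c+1}, …, t_g⟩` (for `0 ≤ c ≤ g`);
in the 0-based indexing of `Fin g` it is generated by the simple reflections with index
`≥ g − c`.  In particular `W_0` is trivial. -/
def Wc (g : ℕ) {W : Type*} [Group W] (cs : CoxeterSystem (CFinMatrix g) W) (c : ℕ) :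
    Subgroup W :=
  Subgroup.closure (cs.simple '' {j : Fin g | g - c ≤ (j : ℕ)})

/-- The set `ᶜW = {w ∈ W_c : ℓ(t_j w) > ℓ(w) for all g−c+1 ≤ j ≤ g−1}` of minimal-length
representatives of the cosets `⟨t_{g−c+1},…,t_{g−1}⟩\W_c` (0-based indexing:
`j` ranges over the indices with `g − c ≤ j ≤ g − 2`). -/
def cW (g : ℕ) {W : Type*} [Group W] (cs : CoxeterSystem (CFinMatrix g) W) (c : ℕ) :
    Set W :=
  {w | w ∈ Wc g cs c ∧
    ∀ j : Fin g, g - c ≤ (j : ℕ) → (j : ℕ) < g - 1 →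
      cs.length w < cs.length (cs.simple j * w)}

/-- Simple reflections of type `C_g` whose indices differ by at least `2` commute. -/
theorem commute_simple_of_add_one_lt {g : ℕ} {W : Type*} [Group W]
    (cs : CoxeterSystem (CFinMatrix g) W) {i k : Fin g} (h : (i : ℕ) + 1 < k) :
    Commute (cs.simple i) (cs.simple k) := by
  have hM : CFinMatrix g i k = 2 := by
    change cFinEntry g i k = 2
    rw [cFinEntry, if_neg (by omega), if_pos (Or.inl h)]
  have hsq := cs.simple_mul_simple_pow i k
  rw [hM, pow_two] at hsq
  have := eq_inv_of_mul_eq_one_left hsq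
  rwa [mul_inv_rev, cs.inv_simple, cs.inv_simple] at this

/-- If `s_i` commutes with every letter of `a`, then `i` is a left descent of the product of a
reduced word of the form `a ++ i :: b`. -/
theorem isLeftDescent_wordProd_of_forall_commute {B W : Type*} [Group W] {M : CoxeterMatrix B}
    (cs : CoxeterSystem M W) {a b : List B} {i : B} (hred : cs.IsReduced (a ++ i :: b))
    (hcomm : ∀ k ∈ a, Commute (cs.simple i) (cs.simple k)) :
    cs.IsLeftDescent (cs.wordProd (a ++ i :: b)) i := by
  have ha : Commute (cs.simple i) (cs.wordProd a) := by
    refine Commute.list_prod_right _ _ fun x hx ↦ ?_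
    obtain ⟨k, hk, rfl⟩ := List.mem_map.1 hx
    exact hcomm k hk
  have hprod : cs.simple i * cs.wordProd (a ++ i :: b) = cs.wordProd (a ++ b) := by
    rw [cs.wordProd_append, cs.wordProd_append, cs.wordProd_cons, ← mul_assoc, ha.eq, mul_assoc,
      cs.simple_mul_simple_cancel_left]
  have hle := cs.length_wordProd_le (a ++ b)
  rw [CoxeterSystem.IsLeftDescent, hprod, hred.eq]
  simp only [List.length_append, List.length_cons] at hle ⊢
  omega

/-- If a reduced word of type `C_g` contains an index at most `j` but not `j + 1`, then its
product has a left descent at some index at most `j`. -/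
theorem exists_isLeftDescent_of_succ_notMem {g : ℕ} {W : Type*} [Group W]
    (cs : CoxeterSystem (CFinMatrix g) W) {ω : List (Fin g)} (hred : cs.IsReduced ω) {j : ℕ}
    (hj : ∃ i ∈ ω, (i : ℕ) ≤ j) (hsucc : ∀ k ∈ ω, (k : ℕ) ≠ j + 1) :
    ∃ i : Fin g, (i : ℕ) ≤ j ∧ cs.IsLeftDescent (cs.wordProd ω) i := by
  have hsome : (ω.find? (fun k : Fin g ↦ decide ((k : ℕ) ≤ j))).isSome := by
    simpa [List.find?_isSome] using hj
  obtain ⟨i, hi⟩ := Option.isSome_iff_exists.1 hsome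
  obtain ⟨hij, a, b, rfl, ha⟩ := List.find?_eq_some_iff_append.1 hi
  replace hij : (i : ℕ) ≤ j := by simpa using hij
  replace ha : ∀ k ∈ a, j < (k : ℕ) := by simpa using ha
  refine ⟨i, hij, isLeftDescent_wordProd_of_forall_commute cs hred fun k hk ↦ ?_⟩
  have h₁ := ha k hk
  have h₂ := hsucc k (List.mem_append_left _ hk)
  exact commute_simple_of_add_one_lt cs (by omega)

/-- The support of an element of `ᵍW` is closed under passing to larger indices. -/
theorem mem_supp_of_le_of_mem_gW {g : ℕ} {W : Type*} [Group W]
    (cs : CoxeterSystem (CFinMatrix g) W) {w : W} (hw : w ∈ cW g cs g) {j k : Fin g}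
    (hj : j ∈ supp cs w) (hjk : (j : ℕ) ≤ k) : k ∈ supp cs w := by
  obtain ⟨ω, hred, rfl, hjω⟩ := hj
  refine ⟨ω, hred, rfl, ?_⟩
  by_contra hk
  have hlt : (j : ℕ) < k := lt_of_le_of_ne hjk fun h ↦ hk (Fin.ext h ▸ hjω)
  obtain ⟨i, hi, hdesc⟩ := exists_isLeftDescent_of_succ_notMem cs hred
    (j := (k : ℕ) - 1) ⟨j, hjω, by omega⟩ fun l hl hlk ↦
      hk ((Fin.ext (by omega) : l = k) ▸ hl)
  exact lt_asymm (hw.2 i (by omega) (by omega)) hdesc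

/-- For every `w ∈ ᵍW` with `w ≠ 1`, the support of `w` is an interval ending at `t_g`:
there exists `i` with `1 ≤ i ≤ g` such that `supp(w) = {t_i, t_{i+1}, …, t_g}`
(in the 0-based indexing of `Fin g`, the set of indices `≥ i − 1`). -/
theorem supp_interval_of_mem_gW (g : ℕ) (hg : 2 ≤ g) {W : Type*} [Group W]
    (cs : CoxeterSystem (CFinMatrix g) W) (w : W) (hw : w ∈ cW g cs g) (hw1 : w ≠ 1) :
    ∃ i : ℕ, 1 ≤ i ∧ i ≤ g ∧ supp cs w = {j : Fin g | i - 1 ≤ (j : ℕ)} := by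
  classical
  have hne : ∃ n : ℕ, ∃ j : Fin g, (j : ℕ) = n ∧ j ∈ supp cs w := by
    obtain ⟨ω, hred, rfl⟩ := cs.exists_isReduced w
    cases ω with
    | nil => simp at hw1
    | cons j ω => exact ⟨j, j, rfl, j :: ω, hred, rfl, List.mem_cons_self⟩
  obtain ⟨j, hjn, hj⟩ := Nat.find_spec hne
  refine ⟨(j : ℕ) + 1, by omega, by omega, Set.ext fun k ↦ ⟨fun hk ↦ ?_, fun hk ↦ ?_⟩⟩
  · have := Nat.find_min' hne ⟨k, rfl, hk⟩
    change (j : ℕ) + 1 - 1 ≤ k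
    omega
  · exact mem_supp_of_le_of_mem_gW cs hw hj hk
end
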